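/- Let l > 0. For every Schwartz function φ on ℝ^4 the double integral below is absolutely convergent and ∫_{ℝ^4}∫_{ℝ^4} |x|^{−4} |y|^{−4} log(|x|/l) log(|y|/l) Σ_{i,j=1}^{4} x_i y_j (∂_i ∂_j φ)(x+y) dx dy = −2π² ∫_{ℝ^4} |z|^{−4} (log(|z|/l))² (z·∇φ(z)) dz − π⁴ φ(0). (This is the renormalized bikini (two-bubble chain) amplitude: the convolution R_4[r^{−4}] * R_4[r^{−4}] equals 4π² R_4[r^{−4} log(r/l)] − π⁴ δ.) -/

import Mathlib

open MeasureTheory Real SchwartzMap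

noncomputable section

local notation "E4" => EuclideanSpace ℝ (Fin 4)

/-- local singular part -/
def gA (r : ℝ) : ℝ := if r ≤ 1 then r ^ (-(7/2) : ℝ) else 0
/-- tail part -/
def gB (r : ℝ) : ℝ := if r ≤ 1 then 0 else r ^ (-(5/2) : ℝ)

lemma gA_nonneg {r : ℝ} (hr : 0 ≤ r) : 0 ≤ gA r := by
  unfold gA; split_ifs <;> positivity

lemma gB_nonneg (r : ℝ) : 0 ≤ gB r := by
  unfold gB; split_ifs with h
  · exact le_rfl
  · push Not at h; positivity

lemma gB_le_one (r : ℝ) : gB r ≤ 1 := by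
  unfold gB; split_ifs with h
  · exact zero_le_one
  · push Not at h; exact Real.rpow_le_one_of_one_le_of_nonpos h.le (by norm_num)

lemma gA_measurable : Measurable gA := by
  unfold gA
  exact Measurable.ite measurableSet_Iic (by fun_prop) (by fun_prop)

lemma gB_measurable : Measurable gB := by
  unfold gB
  exact Measurable.ite measurableSet_Iic (by fun_prop) (by fun_prop)

lemma gA_integrable : Integrable (fun x : E4 => gA ‖x‖) := by
  rw [integrable_fun_norm_addHaar volume (f := gA)]
  have h : IntegrableOn (fun y : ℝ => y ^ (-(1/2) : ℝ)) (Set.Ioc 0 1) := by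
    have := intervalIntegral.intervalIntegrable_rpow' (a := 0) (b := 1) (r := -(1/2)) (by norm_num)
    rwa [intervalIntegrable_iff_integrableOn_Ioc_of_le zero_le_one] at this
  have h2 : IntegrableOn (fun y : ℝ => (Set.Ioc (0:ℝ) 1).indicator (fun y : ℝ => y ^ (-(1/2) : ℝ)) y)
      (Set.Ioi 0) := by
    exact ((integrable_indicator_iff measurableSet_Ioc).2 h).integrableOn
  refine h2.congr_fun (fun y hy => ?_) measurableSet_Ioi
  have hy : 0 < y := hy
  simp only [Set.indicator, Set.mem_Ioc, hy, true_and, gA, finrank_euclideanSpace, Fintype.card_fin]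
  split_ifs
  · rw [smul_eq_mul, ← Real.rpow_natCast, ← Real.rpow_add hy]; norm_num
  · simp

lemma gB_integrable : Integrable (fun x : E4 => gB ‖x‖ ^ 2) := by
  rw [integrable_fun_norm_addHaar volume (f := fun r => gB r ^ 2)]
  have h : IntegrableOn (fun y : ℝ => y ^ (-2 : ℝ)) (Set.Ioi 1) :=
    integrableOn_Ioi_rpow_of_lt (by norm_num) zero_lt_one
  have h2 : IntegrableOn (fun y : ℝ => (Set.Ioi (1:ℝ)).indicator (fun y : ℝ => y ^ (-2 : ℝ)) y)
      (Set.Ioi 0) := by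
    exact ((integrable_indicator_iff measurableSet_Ioi).2 h).integrableOn
  refine h2.congr_fun (fun y hy => ?_) measurableSet_Ioi
  have hy : 0 < y := hy
  simp only [Set.indicator, Set.mem_Ioi, gB, finrank_euclideanSpace, Fintype.card_fin]
  split_ifs with h1 h2 h2
  · linarith
  · rw [smul_eq_mul, ← Real.rpow_natCast, ← Real.rpow_natCast, ← Real.rpow_mul hy.le, ← Real.rpow_add hy]
    norm_num
  · simp
  · push Not at *; linarith

lemma gAB_int_aux {F : Type*} [NormedAddCommGroup F] [NormedSpace ℝ F] (H : SchwartzMap E4 F) :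
    Integrable (fun q : E4 × E4 => (gA ‖q.1‖ + gB ‖q.1‖) * (gA ‖q.2‖ + gB ‖q.2‖) * ‖H (q.1 + q.2)‖) := by
  obtain ⟨C, hC0, hC⟩ : ∃ C, 0 ≤ C ∧ ∀ z, ‖H z‖ ≤ C := by
    obtain ⟨C, hC⟩ := H.decay 0 0
    exact ⟨C, hC.1.le, fun z => by simpa using hC.2 z⟩
  have hH : Integrable (fun z => ‖H z‖) := H.integrable.norm
  have hG : Integrable (fun x : E4 => gA ‖x‖ + gB ‖x‖ ^ 2) := gA_integrable.add gB_integrable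
  have hGH : Integrable (fun q : E4 × E4 => (gA ‖q.1‖ + gB ‖q.1‖ ^ 2) * ‖H (q.1 + q.2)‖) :=
    (measurePreserving_prod_add (volume : Measure E4) (volume : Measure E4)).integrable_comp_of_integrable
      (hG.mul_prod hH)
  have hGH2 : Integrable (fun q : E4 × E4 => (gA ‖q.2‖ + gB ‖q.2‖ ^ 2) * ‖H (q.1 + q.2)‖) := by
    have := hGH.swap
    refine this.congr (Filter.Eventually.of_forall fun q => ?_)
    simp [add_comm]
  have hAA : Integrable (fun q : E4 × E4 => gA ‖q.1‖ * gA ‖q.2‖) := gA_integrable.mul_prod gA_integrable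
  refine Integrable.mono' ((hAA.const_mul C).add (hGH.add hGH2)) ?_ ?_
  · have := gA_measurable
    have := gB_measurable
    have hc := H.continuous
    have : Measurable (fun q : E4 × E4 => ‖H (q.1 + q.2)‖) :=
      Continuous.measurable (by fun_prop)
    exact Measurable.aestronglyMeasurable (by fun_prop)
  · refine Filter.Eventually.of_forall fun q => ?_
    have a1 := gA_nonneg (norm_nonneg q.1)
    have a2 := gA_nonneg (norm_nonneg q.2)
    have b1 := gB_nonneg ‖q.1‖
    have b2 := gB_nonneg ‖q.2‖
    have c1 := gB_le_one ‖q.1‖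
    have c2 := gB_le_one ‖q.2‖
    have h0 := norm_nonneg (H (q.1 + q.2))
    have h1 := hC (q.1 + q.2)
    rw [Real.norm_of_nonneg (by positivity)]
    simp only [Pi.add_apply]
    generalize gA ‖q.1‖ = A at *
    generalize gA ‖q.2‖ = A' at *
    generalize gB ‖q.1‖ = B at *
    generalize gB ‖q.2‖ = B' at *
    generalize ‖H (q.1 + q.2)‖ = h at *
    have e1 : A * A' * h ≤ C * (A * A') := by
      rw [mul_comm C]; exact mul_le_mul_of_nonneg_left h1 (by positivity)
    have e2 : A * B' + A' * B + B * B' ≤ A + A' + B^2 + B'^2 := by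
      nlinarith [mul_le_mul_of_nonneg_left c1 a2, mul_le_mul_of_nonneg_left c2 a1, sq_nonneg (B - B'),
        sq_nonneg (B+B')]
    nlinarith [mul_le_mul_of_nonneg_right e2 h0]

lemma log_sq_bound (t : ℝ) (ht : 0 < t) : Real.log t ^ 2 ≤ 16 * (t ^ (1/2 : ℝ) + t ^ (-(1/2) : ℝ)) := by
  have h1 := Real.log_le_rpow_div ht.le (ε := 1/4) (by norm_num)
  have h2 := Real.log_le_rpow_div (inv_pos.2 ht).le (ε := 1/4) (by norm_num)
  rw [Real.log_inv] at h2
  have e1 : t ^ (1/2 : ℝ) = (t ^ (1/4 : ℝ))^2 := by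
    rw [← Real.rpow_natCast, ← Real.rpow_mul ht.le]; norm_num
  have e2 : t ^ (-(1/2) : ℝ) = (t⁻¹ ^ (1/4 : ℝ))^2 := by
    rw [← Real.rpow_natCast, ← Real.rpow_mul (inv_pos.2 ht).le, Real.inv_rpow ht.le, Real.rpow_neg ht.le]; norm_num
  rw [e1, e2]
  have p1 : 0 < t ^ (1/4 : ℝ) := by positivity
  have p2 : 0 < t⁻¹ ^ (1/4 : ℝ) := by positivity
  rcases le_total 0 (Real.log t) with h | h <;> nlinarith

lemma weight_bound (l : ℝ) (hl : 0 < l) : ∃ C, 0 < C ∧ ∀ r : ℝ, 0 ≤ r →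
    r ^ (-(4:ℝ)) * r * (1 + Real.log (r / l) ^ 2) ≤ C * (gA r + gB r) := by
  set c := 16 * (l ^ (-(1/2) : ℝ) + l ^ (1/2 : ℝ)) with hc
  have hc0 : 0 < c := by positivity
  refine ⟨1 + 2 * c, by positivity, fun r hr => ?_⟩
  rcases hr.eq_or_lt with rfl | hr
  · have := gA_nonneg le_rfl
    have := gB_nonneg 0
    simp only [mul_zero, zero_mul]; positivity
  have h1 : Real.log (r / l) ^ 2 ≤ c * (r ^ (1/2 : ℝ) + r ^ (-(1/2) : ℝ)) := by
    refine (log_sq_bound (r/l) (by positivity)).trans ?_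
    rw [Real.div_rpow hr.le hl.le, Real.div_rpow hr.le hl.le, Real.rpow_neg hl.le, hc, Real.rpow_neg hl.le]
    have : 0 < l ^ (1/2:ℝ) := by positivity
    have : 0 < r ^ (1/2:ℝ) := by positivity
    have : 0 < r ^ (-(1/2):ℝ) := by positivity
    rw [div_inv_eq_mul, div_eq_mul_inv]
    have : 0 < (l ^ (1/2:ℝ))⁻¹ := by positivity
    nlinarith [mul_pos ‹0 < l ^ (1/2:ℝ)› ‹0 < r ^ (1/2:ℝ)›, mul_pos ‹0 < (l ^ (1/2:ℝ))⁻¹› ‹0 < r ^ (-(1/2):ℝ)›]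
  have e0 : r ^ (-(4:ℝ)) * r = r ^ (-3:ℝ) := by
    rw [← Real.rpow_add_one hr.ne']; norm_num
  have e1 : r ^ (-3:ℝ) * r ^ (1/2 : ℝ) = r ^ (-(5/2):ℝ) := by
    rw [← Real.rpow_add hr]; norm_num
  have e2 : r ^ (-3:ℝ) * r ^ (-(1/2) : ℝ) = r ^ (-(7/2):ℝ) := by
    rw [← Real.rpow_add hr]; norm_num
  have p3 : 0 < r ^ (-3:ℝ) := by positivity
  have key : r ^ (-(4:ℝ)) * r * (1 + Real.log (r / l) ^ 2) ≤
      r ^ (-3:ℝ) + c * (r ^ (-(5/2):ℝ) + r ^ (-(7/2):ℝ)) := by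
    rw [e0, ← e1, ← e2]
    nlinarith [mul_le_mul_of_nonneg_left h1 p3.le]
  refine key.trans ?_
  unfold gA gB
  split_ifs with hr1
  · have f1 : r ^ (-3:ℝ) ≤ r ^ (-(7/2):ℝ) := Real.rpow_le_rpow_of_exponent_ge hr hr1 (by norm_num)
    have f2 : r ^ (-(5/2):ℝ) ≤ r ^ (-(7/2):ℝ) := Real.rpow_le_rpow_of_exponent_ge hr hr1 (by norm_num)
    nlinarith
  · push Not at hr1
    have f1 : r ^ (-3:ℝ) ≤ r ^ (-(5/2):ℝ) := Real.rpow_le_rpow_of_exponent_le hr1.le (by norm_num)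
    have f2 : r ^ (-(7/2):ℝ) ≤ r ^ (-(5/2):ℝ) := Real.rpow_le_rpow_of_exponent_le hr1.le (by norm_num)
    nlinarith

/-- second derivative as a Schwartz map -/
def D2 (φ : SchwartzMap E4 ℝ) : SchwartzMap E4 (E4 →L[ℝ] E4 →L[ℝ] ℝ) :=
  SchwartzMap.fderivCLM ℝ E4 (E4 →L[ℝ] ℝ) (SchwartzMap.fderivCLM ℝ E4 ℝ φ)

/-- the kernel -/
def ker (φ : SchwartzMap E4 ℝ) (q : E4 × E4) : ℝ :=
  ‖q.1‖ ^ (-(4 : ℝ)) * ‖q.2‖ ^ (-(4 : ℝ)) * D2 φ (q.1 + q.2) q.1 q.2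

lemma ker_measurable (φ : SchwartzMap E4 ℝ) : Measurable (ker φ) := by
  unfold ker
  have : Continuous (fun q : E4 × E4 => D2 φ (q.1 + q.2) q.1 q.2) := by
    have := (D2 φ).continuous
    fun_prop
  have := this.measurable
  fun_prop

lemma ker_integrable (l : ℝ) (hl : 0 < l) (φ : SchwartzMap E4 ℝ) (w : E4 × E4 → ℝ) (hw : Measurable w)
    (c : ℝ) (hb : ∀ q, |w q| ≤ c * ((1 + Real.log (‖q.1‖ / l) ^ 2) * (1 + Real.log (‖q.2‖ / l) ^ 2))) :
    Integrable (fun q => w q * ker φ q) := by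
  obtain ⟨C, hC, hCb⟩ := weight_bound l hl
  refine Integrable.mono' ((gAB_int_aux (D2 φ)).const_mul (|c| * C^2)) 
    (hw.mul (ker_measurable φ)).aestronglyMeasurable (Filter.Eventually.of_forall fun q => ?_)
  have h1 := hCb ‖q.1‖ (norm_nonneg _)
  have h2 := hCb ‖q.2‖ (norm_nonneg _)
  have hB : |D2 φ (q.1 + q.2) q.1 q.2| ≤ ‖D2 φ (q.1 + q.2)‖ * ‖q.1‖ * ‖q.2‖ := 
    (D2 φ (q.1 + q.2)).le_opNorm₂ q.1 q.2
  have g1 := add_nonneg (gA_nonneg (norm_nonneg q.1)) (gB_nonneg ‖q.1‖)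
  have g2 := add_nonneg (gA_nonneg (norm_nonneg q.2)) (gB_nonneg ‖q.2‖)
  have hw' : |w q| ≤ |c| * ((1 + Real.log (‖q.1‖ / l) ^ 2) * (1 + Real.log (‖q.2‖ / l) ^ 2)) :=
    (hb q).trans (mul_le_mul_of_nonneg_right (le_abs_self c) (by positivity))
  rw [norm_mul, Real.norm_eq_abs, Real.norm_eq_abs, ker, abs_mul, abs_mul,
    abs_of_nonneg (by positivity : 0 ≤ ‖q.1‖ ^ (-(4:ℝ))), abs_of_nonneg (by positivity : 0 ≤ ‖q.2‖ ^ (-(4:ℝ)))]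
  calc _ ≤ (|c| * ((1 + Real.log (‖q.1‖ / l) ^ 2) * (1 + Real.log (‖q.2‖ / l) ^ 2))) *
        (‖q.1‖ ^ (-(4:ℝ)) * ‖q.2‖ ^ (-(4:ℝ)) * (‖D2 φ (q.1 + q.2)‖ * ‖q.1‖ * ‖q.2‖)) := by gcongr
    _ = |c| * ((‖q.1‖ ^ (-(4:ℝ)) * ‖q.1‖ * (1 + Real.log (‖q.1‖ / l) ^ 2)) *
        (‖q.2‖ ^ (-(4:ℝ)) * ‖q.2‖ * (1 + Real.log (‖q.2‖ / l) ^ 2))) * ‖D2 φ (q.1 + q.2)‖ := by ring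
    _ ≤ |c| * ((C * (gA ‖q.1‖ + gB ‖q.1‖)) * (C * (gA ‖q.2‖ + gB ‖q.2‖))) * ‖D2 φ (q.1 + q.2)‖ := by
      gcongr
    _ = _ := by ring

lemma radial_int (ψ : SchwartzMap E4 ℝ) (c : E4) :
    Integrable (fun y : E4 => ‖y‖ ^ (-(4:ℝ)) * fderiv ℝ ψ (c + y) y) := by
  set H := SchwartzMap.fderivCLM ℝ E4 ℝ ψ with hH
  have hHf : ∀ z, fderiv ℝ ψ z = H z := fun z => rfl
  obtain ⟨C, hC0, hC⟩ : ∃ C, 0 ≤ C ∧ ∀ z, ‖H z‖ ≤ C := by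
    obtain ⟨C, hC⟩ := H.decay 0 0
    exact ⟨C, hC.1.le, fun z => by simpa using hC.2 z⟩
  obtain ⟨K, hK, hKb⟩ := weight_bound 1 one_pos
  have hHi : Integrable (fun y => ‖H (c + y)‖) := H.integrable.norm.comp_add_left c
  have hm : Measurable (fun y : E4 => H (c + y) y) := by
    have := H.continuous
    exact Continuous.measurable (by fun_prop)
  simp only [hHf]
  refine Integrable.mono' ((gA_integrable.const_mul (K * C)).add (hHi.const_mul K))
    (Measurable.aestronglyMeasurable (by fun_prop)) (Filter.Eventually.of_forall fun y => ?_)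
  have h1 := hKb ‖y‖ (norm_nonneg _)
  have h2 : |H (c + y) y| ≤ ‖H (c + y)‖ * ‖y‖ := (H (c+y)).le_opNorm y
  have a := gA_nonneg (norm_nonneg y)
  have b := gB_nonneg ‖y‖
  have b1 := gB_le_one ‖y‖
  have h3 : ‖y‖ ^ (-(4:ℝ)) * ‖y‖ ≤ K * (gA ‖y‖ + gB ‖y‖) := by
    refine le_trans ?_ h1
    have : 0 ≤ ‖y‖ ^ (-(4:ℝ)) * ‖y‖ := by positivity
    nlinarith [mul_nonneg this (sq_nonneg (Real.log (‖y‖ / 1)))]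
  rw [norm_mul, Real.norm_eq_abs, Real.norm_eq_abs, abs_of_nonneg (by positivity : 0 ≤ ‖y‖ ^ (-(4:ℝ)))]
  simp only [Pi.add_apply]
  calc _ ≤ ‖y‖ ^ (-(4:ℝ)) * (‖H (c + y)‖ * ‖y‖) := by gcongr
    _ = (‖y‖ ^ (-(4:ℝ)) * ‖y‖) * ‖H (c + y)‖ := by ring
    _ ≤ K * (gA ‖y‖ + gB ‖y‖) * ‖H (c + y)‖ := by gcongr
    _ = K * gA ‖y‖ * ‖H (c + y)‖ + K * (gB ‖y‖ * ‖H (c + y)‖) := by ring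
    _ ≤ K * gA ‖y‖ * C + K * (1 * ‖H (c + y)‖) := by gcongr; exact hC _
    _ = _ := by ring

lemma radial_line (ψ : SchwartzMap E4 ℝ) (c : E4) (ω : E4) (hω : ‖ω‖ = 1) :
    ∫ r in Set.Ioi (0:ℝ), fderiv ℝ ψ (c + r • ω) ω = - ψ c := by
  set H := SchwartzMap.fderivCLM ℝ E4 ℝ ψ with hH
  have hHf : ∀ z, fderiv ℝ ψ z = H z := fun z => rfl
  have hder : ∀ x ∈ Set.Ici (0:ℝ), HasDerivAt (fun r : ℝ => ψ (c + r • ω)) (fderiv ℝ ψ (c + x • ω) ω) x := by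
    intro x _
    have h1 : HasDerivAt (fun r : ℝ => c + r • ω) ω x := by
      simpa using ((hasDerivAt_id x).smul_const ω).const_add c
    exact (ψ.differentiableAt.hasFDerivAt (x := c + x • ω)).comp_hasDerivAt x h1
  have hcoc : Filter.Tendsto (fun r : ℝ => c + r • ω) Filter.atTop (Filter.cocompact E4) := by
    rw [← Metric.cobounded_eq_cocompact, ← tendsto_norm_atTop_iff_cobounded]
    refine Filter.tendsto_atTop_mono (f := fun r : ℝ => r - ‖c‖) (fun r => ?_)
      (Filter.tendsto_atTop_add_const_right _ _ Filter.tendsto_id)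
    have h1 : ‖r • ω‖ ≤ ‖c + r • ω‖ + ‖c‖ := by
      have := norm_sub_le (c + r • ω) c
      simpa using this
    rw [norm_smul, hω, mul_one] at h1
    have := le_abs_self r
    simp only [Real.norm_eq_abs] at h1
    linarith
  have hlim : Filter.Tendsto (fun r : ℝ => ψ (c + r • ω)) Filter.atTop (nhds 0) :=
    (ψ.tendsto_cocompact).comp hcoc
  have hInt : IntegrableOn (fun r : ℝ => fderiv ℝ ψ (c + r • ω) ω) (Set.Ioi 0) := by
    obtain ⟨C, hC⟩ := H.decay 2 0
    obtain ⟨C0, hC0⟩ := H.decay 0 0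
    have hb : Integrable (fun r : ℝ => (C0 * (1 + 2 * ‖c‖^2) + 2 * C) * (1 + r^2)⁻¹) := integrable_inv_one_add_sq.const_mul _
    refine (Integrable.mono' hb ?_ (Filter.Eventually.of_forall fun r => ?_)).integrableOn
    · simp only [hHf]
      have := H.continuous
      exact Continuous.aestronglyMeasurable (by fun_prop)
    · have h1 := hC.2 (c + r • ω)
      have h0 := hC0.2 (c + r • ω)
      simp only [norm_iteratedFDeriv_zero, pow_zero, one_mul] at h1 h0
      have h2 : ‖H (c + r • ω) ω‖ ≤ ‖H (c + r • ω)‖ := by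
        simpa [hω] using (H (c + r • ω)).le_opNorm ω
      rw [hHf, ← div_eq_mul_inv, le_div_iff₀ (by positivity)]
      have h3 : r^2 ≤ 2 * ‖c + r • ω‖^2 + 2 * ‖c‖^2 := by
        have h1 : ‖r • ω‖ ≤ ‖c + r • ω‖ + ‖c‖ := by
          have := norm_sub_le (c + r • ω) c
          simpa using this
        rw [norm_smul, hω, mul_one, Real.norm_eq_abs] at h1
        have h4 : |r|^2 ≤ (‖c + r • ω‖ + ‖c‖)^2 := by gcongr
        rw [sq_abs] at h4
        nlinarith [sq_nonneg (‖c + r • ω‖ - ‖c‖)]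
      have hn := norm_nonneg (H (c + r • ω))
      calc ‖H (c + r • ω) ω‖ * (1 + r^2) ≤ ‖H (c + r • ω)‖ * (1 + (2 * ‖c + r • ω‖^2 + 2 * ‖c‖^2)) := by gcongr
        _ = ‖H (c + r • ω)‖ * (1 + 2 * ‖c‖^2) + 2 * (‖c + r • ω‖^2 * ‖H (c + r • ω)‖) := by ring
        _ ≤ _ := by gcongr
  have := integral_Ioi_of_hasDerivAt_of_tendsto' hder hInt hlim
  simpa using this

lemma sphere_vol : (volume : Measure E4).toSphere.real Set.univ = 2 * π ^ 2 := by
  rw [Measure.toSphere_real_apply_univ, measureReal_def,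
    InnerProductSpace.volume_ball_of_dim_even (k := 2) (by simp)]
  simp [Nat.factorial]
  rw [ENNReal.toReal_ofReal (by positivity)]; ring

lemma radial_eval (ψ : SchwartzMap E4 ℝ) (c : E4) :
    ∫ y : E4, ‖y‖ ^ (-(4:ℝ)) * fderiv ℝ ψ (c + y) y = -(2 * π ^ 2) * ψ c := by
  set f : E4 → ℝ := fun y => ‖y‖ ^ (-(4:ℝ)) * fderiv ℝ ψ (c + y) y with hf
  have hInt : Integrable f := radial_int ψ c
  have hd : Module.finrank ℝ E4 - 1 = 3 := by simp
  have mp := (volume : Measure E4).measurePreserving_homeomorphUnitSphereProd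
  have me := (homeomorphUnitSphereProd E4).measurableEmbedding
  set g : Metric.sphere (0:E4) 1 × Set.Ioi (0:ℝ) → ℝ := fun p => f (p.2.1 • p.1.1) with hg
  have hgf : ∀ x : ({0}ᶜ : Set E4), g (homeomorphUnitSphereProd E4 x) = f x := by
    intro x
    have := (homeomorphUnitSphereProd E4).symm_apply_apply x
    have h2 := congrArg Subtype.val this
    rw [homeomorphUnitSphereProd_symm_apply_coe] at h2
    simp only [hg]; rw [h2]
  have hgi : Integrable g ((volume : Measure E4).toSphere.prod (.volumeIoiPow (Module.finrank ℝ E4 - 1))) := by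
    rw [← mp.integrable_comp_emb me]
    have : (g ∘ (homeomorphUnitSphereProd E4)) = fun x : ({0}ᶜ : Set E4) => f x := funext hgf
    rw [this]
    have h3 := (integrableOn_iff_comap_subtypeVal (μ := (volume : Measure E4)) (f := f) (s := {0}ᶜ)
      (measurableSet_singleton _).compl).1 hInt.integrableOn
    exact h3
  calc ∫ y, f y = ∫ x : ({(0)}ᶜ : Set E4), f x.1 ∂((volume : Measure E4).comap (↑)) := by
        rw [integral_subtype_comap (measurableSet_singleton _).compl f, restrict_compl_singleton]
    _ = ∫ p, g p ∂((volume : Measure E4).toSphere.prod (.volumeIoiPow (Module.finrank ℝ E4 - 1))) := by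
        rw [← mp.integral_comp me g]
        simp only [hgf]
    _ = ∫ ω, ∫ r, g (ω, r) ∂(Measure.volumeIoiPow (Module.finrank ℝ E4 - 1)) ∂(volume : Measure E4).toSphere :=
        integral_prod _ hgi
    _ = ∫ ω : Metric.sphere (0:E4) 1, - ψ c ∂(volume : Measure E4).toSphere := by
        congr 1; ext ω
        rw [hd]
        simp only [Measure.volumeIoiPow, ENNReal.ofReal]
        rw [integral_withDensity_eq_integral_smul (measurable_subtype_coe.pow_const _).real_toNNReal]
        have hω : ‖(ω : E4)‖ = 1 := by simp
        rw [← radial_line ψ c ω hω]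
        rw [integral_subtype_comap measurableSet_Ioi
          (fun a : ℝ => Real.toNNReal (a ^ 3) • f (a • (ω : E4)))]
        refine setIntegral_congr_fun measurableSet_Ioi fun r hr => ?_
        have hr : 0 < r := hr
        simp only [hf]
        rw [NNReal.smul_def, Real.coe_toNNReal _ (by positivity), norm_smul, hω, mul_one,
          Real.norm_of_nonneg hr.le, map_smul, smul_eq_mul, smul_eq_mul]
        have : r ^ 3 * (r ^ (-(4:ℝ)) * r) = 1 := by
          rw [Real.rpow_neg hr.le]
          have : r ^ (4:ℝ) = r ^ 4 := by exact_mod_cast Real.rpow_natCast r 4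
          rw [this]; field_simp
        linear_combination (fderiv ℝ ψ (c + r • (ω : E4)) (ω : E4)) * this
    _ = _ := by
        rw [integral_const, sphere_vol]; simp

lemma D2_apply (φ : SchwartzMap E4 ℝ) (z v w : E4) :
    D2 φ z v w = fderiv ℝ (fun z => fderiv ℝ φ z w) z v := by
  have h1 : DifferentiableAt ℝ (fun z => fderiv ℝ φ z) z :=
    (SchwartzMap.fderivCLM ℝ E4 ℝ φ).differentiableAt
  rw [fderiv_clm_apply h1 (differentiableAt_const _)]
  simp [D2]
  rfl

lemma D2_symm (φ : SchwartzMap E4 ℝ) (z v w : E4) : D2 φ z v w = D2 φ z w v := by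
  have h : ContDiffAt ℝ 2 φ z := (φ.smooth 2).contDiffAt
  have := h.isSymmSndFDerivAt (by simp)
  exact this v w

lemma D2_sum (φ : SchwartzMap E4 ℝ) (z v w : E4) :
    ∑ i : Fin 4, ∑ j : Fin 4, v i * w j *
      fderiv ℝ (fun z => fderiv ℝ (⇑φ) z (EuclideanSpace.single j 1)) z (EuclideanSpace.single i 1)
      = D2 φ z v w := by
  simp only [← D2_apply]
  have hv : ∀ v : E4, v = ∑ i, v i • (EuclideanSpace.single i (1:ℝ) : E4) := by
    intro v
    have := (EuclideanSpace.basisFun (Fin 4) ℝ).sum_repr v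
    simpa using this.symm
  conv_rhs => rw [hv v, hv w]
  simp only [map_sum, map_smul, sum_apply, smul_apply, smul_eq_mul,
    Finset.mul_sum]
  rw [Finset.sum_comm]
  refine Finset.sum_congr rfl fun i _ => Finset.sum_congr rfl fun j _ => ?_
  ring

lemma ker_swap (φ : SchwartzMap E4 ℝ) (q : E4 × E4) : ker φ q.swap = ker φ q := by
  simp only [ker, Prod.fst_swap, Prod.snd_swap]
  rw [D2_symm, add_comm q.2]; ring

lemma ker_weight_fst (φ : SchwartzMap E4 ℝ) (w : E4 → ℝ) (h : Integrable (fun q : E4 × E4 => w q.1 * ker φ q)) :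
    ∫ q : E4 × E4, w q.1 * ker φ q = -(2 * π^2) * ∫ z : E4, ‖z‖ ^ (-(4:ℝ)) * w z * fderiv ℝ φ z z := by
  rw [Measure.volume_eq_prod, integral_prod _ h, ← integral_const_mul]
  congr 1; ext x
  have := radial_eval (SchwartzMap.evalCLM ℝ E4 ℝ x (SchwartzMap.fderivCLM ℝ E4 ℝ φ)) x
  have h2 : ∀ y, fderiv ℝ (SchwartzMap.evalCLM ℝ E4 ℝ x (SchwartzMap.fderivCLM ℝ E4 ℝ φ)) (x + y) y = D2 φ (x+y) x y := by
    intro y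
    rw [D2_symm, D2_apply]; rfl
  simp only [h2] at this
  simp only [ker]
  calc _ = ∫ y, (w x * ‖x‖ ^ (-(4:ℝ))) * (‖y‖ ^ (-(4:ℝ)) * D2 φ (x+y) x y) := by
        congr 1; ext y; ring
    _ = _ := by
        rw [integral_const_mul, this]
        have : (SchwartzMap.evalCLM ℝ E4 ℝ x (SchwartzMap.fderivCLM ℝ E4 ℝ φ)) x = fderiv ℝ φ x x := rfl
        rw [this]; ring

/-- logistic density -/
def mm (t : ℝ) : ℝ := Real.sigmoid t * (1 - Real.sigmoid t)

lemma mm_pos (t : ℝ) : 0 < mm t := by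
  have := Real.sigmoid_pos t
  have := Real.sigmoid_lt_one t
  unfold mm; apply mul_pos <;> linarith

lemma mm_le_one (t : ℝ) : mm t ≤ 1 := by
  have := Real.sigmoid_pos t
  have := Real.sigmoid_lt_one t
  unfold mm; nlinarith

lemma mm_cont : Continuous mm := by
  have := continuous_sigmoid
  unfold mm; fun_prop

lemma mm_eq (t : ℝ) : mm t = Real.exp t / (1 + Real.exp t) ^ 2 := by
  unfold mm
  rw [Real.sigmoid_def, Real.exp_neg]
  have := Real.exp_pos t
  field_simp
  ring

lemma mm_le (t : ℝ) : mm t ≤ Real.exp (-|t|) := by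
  have h := Real.exp_pos t
  rw [mm_eq, div_le_iff₀ (by positivity)]
  rcases le_total 0 t with h0 | h0
  · rw [abs_of_nonneg h0, Real.exp_neg]
    have : (Real.exp t)⁻¹ * (1 + Real.exp t)^2 = Real.exp t + ((Real.exp t)⁻¹ + 2) := by
      field_simp; ring
    rw [this]
    have : 0 < (Real.exp t)⁻¹ := by positivity
    linarith
  · rw [abs_of_nonpos h0, neg_neg]
    nlinarith [mul_pos h h, mul_pos h (mul_pos h h)]

lemma mm_decay (t : ℝ) : (1 + t^2) * mm t ≤ 29 * (1 + t^2)⁻¹ := by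
  rw [← div_eq_mul_inv, le_div_iff₀ (by positivity)]
  have h1 := mm_le t
  have h2 := Real.pow_div_factorial_le_exp |t| (abs_nonneg t) 4
  have h3 := Real.pow_div_factorial_le_exp |t| (abs_nonneg t) 2
  have h4 : 1 ≤ Real.exp |t| := Real.one_le_exp (abs_nonneg t)
  simp [Nat.factorial] at h2 h3
  have e4 : |t|^4 = t^4 := by rw [← abs_pow]; exact abs_of_nonneg (by positivity)
  have h5 : (1 + t^2)^2 ≤ 29 * Real.exp |t| := by
    rw [e4] at h2; nlinarith
  have h6 : Real.exp |t| * Real.exp (-|t|) = 1 := by rw [← Real.exp_add]; simp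
  have := Real.exp_pos (-|t|)
  calc (1 + t^2) * mm t * (1 + t^2) = (1+t^2)^2 * mm t := by ring
    _ ≤ (1+t^2)^2 * Real.exp (-|t|) := by gcongr
    _ ≤ 29 * Real.exp |t| * Real.exp (-|t|) := by gcongr
    _ = 29 := by rw [mul_assoc, h6, mul_one]

lemma bdd_mm_int (f : ℝ → ℝ) (hf : Continuous f) (C : ℝ) (hC : 0 ≤ C) (h : ∀ t, |f t| ≤ C * ((1 + t^2) * mm t)) :
    Integrable f := by
  refine Integrable.mono' (integrable_inv_one_add_sq.const_mul (C * 29)) hf.aestronglyMeasurable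
    (Filter.Eventually.of_forall fun t => (h t).trans ?_)
  rw [mul_assoc]
  exact mul_le_mul_of_nonneg_left (mm_decay t) hC

lemma bdd_mm_tendsto (f : ℝ → ℝ) (C : ℝ) (hC : 0 ≤ C) (h : ∀ t, |f t| ≤ C * ((1 + t^2) * mm t)) :
    Filter.Tendsto f Filter.atTop (nhds 0) ∧ Filter.Tendsto f Filter.atBot (nhds 0) := by
  have hb : ∀ t, |f t| ≤ (C * 29) * (1 + t^2)⁻¹ := fun t => (h t).trans (by
    rw [mul_assoc]; exact mul_le_mul_of_nonneg_left (mm_decay t) hC)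
  have hsq : Filter.Tendsto (fun t : ℝ => t^2) Filter.atTop Filter.atTop :=
    Filter.tendsto_pow_atTop (by norm_num)
  have hsq' : Filter.Tendsto (fun t : ℝ => t^2) Filter.atBot Filter.atTop := by
    have := hsq.comp Filter.tendsto_neg_atBot_atTop
    simpa [Function.comp_def] using this
  have hl : ∀ F : Filter ℝ, Filter.Tendsto (fun t : ℝ => t^2) F Filter.atTop →
      Filter.Tendsto (fun t : ℝ => (C * 29) * (1 + t^2)⁻¹) F (nhds 0) := by
    intro F hF
    have := (tendsto_inv_atTop_zero.comp (Filter.tendsto_atTop_add_const_left F 1 hF)).const_mul (C * 29)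
    simpa [Function.comp_def] using this
  exact ⟨squeeze_zero_norm hb (hl _ hsq), squeeze_zero_norm hb (hl _ hsq')⟩

/-- derivative of `mm` -/
def mm' (t : ℝ) : ℝ := mm t * (1 - 2 * Real.sigmoid t)

lemma mm_deriv (t : ℝ) : HasDerivAt mm (mm' t) t := by
  have h := hasDerivAt_sigmoid t
  convert! h.mul (h.const_sub 1) using 1
  unfold mm' mm; ring

lemma mm'_deriv (t : ℝ) : HasDerivAt mm' (mm t - 6 * mm t ^ 2) t := by
  have h := hasDerivAt_sigmoid t
  convert! (mm_deriv t).mul ((h.const_mul 2).const_sub 1) using 1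
  unfold mm' mm; ring

lemma mm'_le (t : ℝ) : |mm' t| ≤ mm t := by
  have h0 := mm_pos t
  have := Real.sigmoid_pos t
  have := Real.sigmoid_lt_one t
  unfold mm'
  rw [abs_mul, abs_of_pos h0]
  have : |1 - 2 * Real.sigmoid t| ≤ 1 := by rw [abs_le]; constructor <;> linarith
  nlinarith

lemma mm_sq_le (t : ℝ) : mm t ^ 2 ≤ mm t := by
  nlinarith [mm_pos t, mm_le_one t]

lemma int_mm : Integrable mm := bdd_mm_int _ mm_cont 1 (by norm_num) fun t => by
  have := mm_pos t
  rw [abs_of_pos this]; nlinarith [mul_nonneg (sq_nonneg t) this.le]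

lemma int_mm2 : Integrable (fun t => mm t ^ 2) := bdd_mm_int _ (mm_cont.pow 2) 1 (by norm_num) fun t => by
  have := mm_pos t
  rw [abs_of_nonneg (by positivity)]; nlinarith [mul_nonneg (sq_nonneg t) this.le, mm_sq_le t]

lemma int_tmm : Integrable (fun t => t^2 * mm t) := by
  have := mm_cont
  refine bdd_mm_int _ (by fun_prop) 1 (by norm_num) fun t => ?_
  have := mm_pos t
  rw [abs_of_nonneg (by positivity)]; nlinarith [mul_nonneg (sq_nonneg t) this.le]

lemma int_tmm2 : Integrable (fun t => t^2 * mm t ^ 2) := by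
  have := mm_cont
  refine bdd_mm_int _ (by fun_prop) 1 (by norm_num) fun t => ?_
  have := mm_pos t
  rw [abs_of_nonneg (by positivity)]; nlinarith [mul_nonneg (sq_nonneg t) this.le, mul_le_mul_of_nonneg_left (mm_sq_le t) (sq_nonneg t)]

lemma int_t1mm2 : Integrable (fun t => t * mm t ^ 2) := by
  have := mm_cont
  refine bdd_mm_int _ (by fun_prop) 1 (by norm_num) fun t => ?_
  have h := mm_pos t
  rw [abs_mul, abs_of_nonneg (by positivity : 0 ≤ mm t ^ 2)]
  have h1 : |t| ≤ 1 + t^2 := by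
    rw [abs_le]; constructor <;> nlinarith [sq_nonneg (t+1), sq_nonneg (t-1)]
  calc |t| * mm t ^ 2 ≤ (1 + t^2) * mm t := by gcongr; exact mm_sq_le t
    _ = _ := by ring

lemma val_mm : ∫ t, mm t = 1 := by
  have := integral_of_hasDerivAt_of_tendsto (fun t => hasDerivAt_sigmoid t) int_mm
    tendsto_sigmoid_atBot tendsto_sigmoid_atTop
  exact this.trans (by ring)

lemma val_mm2 : ∫ t, mm t ^ 2 = 1 / 6 := by
  have hi : Integrable (fun t => mm t - 6 * mm t ^ 2) := int_mm.sub (int_mm2.const_mul 6)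
  have ht := bdd_mm_tendsto mm' 1 (by norm_num) fun t => by
    have := mm_pos t
    nlinarith [mul_nonneg (sq_nonneg t) this.le, mm'_le t]
  have := integral_of_hasDerivAt_of_tendsto mm'_deriv hi ht.2 ht.1
  rw [integral_sub int_mm (int_mm2.const_mul 6), integral_const_mul, val_mm] at this
  linarith

lemma val_t1mm2 : ∫ t, t * mm t ^ 2 = 0 := by
  have h := integral_neg_eq_self (fun t => t * mm t ^ 2) (volume : Measure ℝ)
  have e : ∀ t, mm (-t) = mm t := fun t => by unfold mm; rw [Real.sigmoid_neg]; ring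
  simp only [e, neg_mul] at h
  rw [integral_neg] at h
  linarith

lemma val_tmm : ∫ t, t^2 * mm t = 6 * (∫ t, t^2 * mm t ^ 2) + 2 := by
  have hd : ∀ t, HasDerivAt (fun t => t^2 * mm' t - 2 * t * mm t) (t^2 * mm t - 6 * (t^2 * mm t^2) - 2 * mm t) t := by
    intro t
    convert! ((hasDerivAt_pow 2 t).mul (mm'_deriv t)).sub (((hasDerivAt_id t).const_mul 2).mul (mm_deriv t)) using 1
    simp; ring
  have hi1 : Integrable (fun t => t^2 * mm t - 6 * (t^2 * mm t^2)) := int_tmm.sub (int_tmm2.const_mul 6)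
  have hi : Integrable (fun t => t^2 * mm t - 6 * (t^2 * mm t^2) - 2 * mm t) := hi1.sub (int_mm.const_mul 2)
  have ht := bdd_mm_tendsto (fun t => t^2 * mm' t - 2 * t * mm t) 2 (by norm_num) fun t => by
    have h0 := mm_pos t
    have h1 := mm'_le t
    have h2 : |t^2 * mm' t| ≤ t^2 * mm t := by
      rw [abs_mul, abs_of_nonneg (sq_nonneg t)]; gcongr
    have h3 : |2 * t * mm t| ≤ (1 + t^2) * mm t := by
      rw [abs_mul, abs_of_pos h0]
      gcongr
      rw [abs_le]; constructor <;> nlinarith [sq_nonneg (t+1), sq_nonneg (t-1)]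
    calc _ ≤ |t^2 * mm' t| + |2 * t * mm t| := abs_sub _ _
      _ ≤ _ := by nlinarith
  have := integral_of_hasDerivAt_of_tendsto hd hi ht.2 ht.1
  rw [integral_sub hi1 (int_mm.const_mul 2), integral_sub int_tmm (int_tmm2.const_mul 6), integral_const_mul,
    integral_const_mul, val_mm] at this
  linarith

lemma conv_one (s : ℝ) : Integrable (fun t => 1 * mm (t + s) ^ 2) ∧ ∫ t, 1 * mm (t + s) ^ 2 = 1 / 6 := by
  simp only [one_mul]
  exact ⟨int_mm2.comp_add_right s, by rw [integral_add_right_eq_self (fun t => mm t ^ 2), val_mm2]⟩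

lemma conv_sq (s : ℝ) : Integrable (fun t => t^2 * mm (t + s) ^ 2) ∧
    ∫ t, t^2 * mm (t + s) ^ 2 = (∫ t, t^2 * mm t ^ 2) + s^2 / 6 := by
  have e : (fun t => t^2 * mm (t + s) ^ 2) = fun t =>
    (fun t => (t^2 * mm t ^ 2 - 2 * s * (t * mm t ^ 2)) + s^2 * mm t ^ 2) (t + s) := by
    ext t; ring
  have i1 : Integrable (fun t => t^2 * mm t ^ 2 - 2 * s * (t * mm t ^ 2)) :=
    int_tmm2.sub (int_t1mm2.const_mul _)
  have i2 : Integrable (fun t => s^2 * mm t ^ 2) := int_mm2.const_mul _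
  rw [e]
  refine ⟨(i1.add i2).comp_add_right s, ?_⟩
  rw [integral_add_right_eq_self (fun t => (t^2 * mm t ^ 2 - 2 * s * (t * mm t ^ 2)) + s^2 * mm t ^ 2),
    integral_add i1 i2, integral_sub int_tmm2 (int_t1mm2.const_mul _), integral_const_mul, integral_const_mul,
    val_t1mm2, val_mm2]
  ring

/-- log ratio -/
def sg (l : ℝ) (q : E4 × E4) : ℝ := 2 * (Real.log (‖q.1‖ / l) - Real.log (‖q.2‖ / l))

lemma sg_measurable (l : ℝ) : Measurable (sg l) := by
  unfold sg; fun_prop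

lemma mm_sg (l : ℝ) (hl : 0 < l) (t : ℝ) (x y : E4) (hx : x ≠ 0) (hy : y ≠ 0) (B : ℝ) :
    mm (t + sg l (x, y)) ^ 2 * (‖x‖ ^ (-(4:ℝ)) * ‖y‖ ^ (-(4:ℝ)) * B) =
      mm t ^ 2 * (B / (Real.sigmoid t * ‖x‖^2 + (1 - Real.sigmoid t) * ‖y‖^2) ^ 4) := by
  have hx' : 0 < ‖x‖ := norm_pos_iff.2 hx
  have hy' : 0 < ‖y‖ := norm_pos_iff.2 hy
  have e1 : Real.exp (t + sg l (x, y)) = Real.exp t * (‖x‖^2 / ‖y‖^2) := by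
    rw [Real.exp_add]
    congr 1
    simp only [sg]
    rw [← Real.log_div (by positivity) (by positivity), two_mul, Real.exp_add, Real.exp_log (by positivity)]
    field_simp
  have r : ∀ a : ℝ, 0 < a → a ^ (-(4:ℝ)) = (a^4)⁻¹ := by
    intro a ha
    rw [Real.rpow_neg ha.le]
    congr 1
    exact_mod_cast Real.rpow_natCast a 4
  have s1 : Real.sigmoid t = Real.exp t / (1 + Real.exp t) := by
    rw [Real.sigmoid_def, Real.exp_neg]
    have := Real.exp_pos t
    field_simp; ring
  rw [mm_eq, mm_eq, e1, r _ hx', r _ hy', s1]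
  have := Real.exp_pos t
  generalize Real.exp t = e at *
  have h1 : 1 - e / (1 + e) = 1 / (1 + e) := by field_simp; ring
  rw [h1]
  have h2 : e / (1 + e) * ‖x‖^2 + 1 / (1 + e) * ‖y‖^2 = (e * ‖x‖^2 + ‖y‖^2) / (1 + e) := by field_simp
  have h3 : 1 + e * (‖x‖^2 / ‖y‖^2) = (e * ‖x‖^2 + ‖y‖^2) / ‖y‖^2 := by field_simp; ring
  rw [h2, h3]
  have : 0 < e * ‖x‖^2 + ‖y‖^2 := by positivity
  generalize e * ‖x‖^2 + ‖y‖^2 = d at *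
  field_simp

/-- the rescaled inner integral -/
def Hin (φ : SchwartzMap E4 ℝ) (p : ℝ) (z : E4) : ℝ :=
  ∫ w : E4, (p * D2 φ z z z - D2 φ z w w) / (p * ‖z‖^2 + ‖w‖^2) ^ 4

lemma Hin_scale (φ : SchwartzMap E4 ℝ) (p : ℝ) (hp : 0 < p) (z : E4) :
    Hin φ p z = p⁻¹ * Hin φ 1 z := by
  have h := Measure.integral_comp_smul (volume : Measure E4)
    (fun w : E4 => (p * D2 φ z z z - D2 φ z w w) / (p * ‖z‖^2 + ‖w‖^2) ^ 4) (√p)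
  have hs : √p ^ 2 = p := Real.sq_sqrt hp.le
  have e : ∀ w : E4, (p * D2 φ z z z - D2 φ z (√p • w) (√p • w)) / (p * ‖z‖^2 + ‖√p • w‖^2) ^ 4 =
      (p^3)⁻¹ * ((1 * D2 φ z z z - D2 φ z w w) / (1 * ‖z‖^2 + ‖w‖^2) ^ 4) := by
    intro w
    have e1 : D2 φ z (√p • w) (√p • w) = p * D2 φ z w w := by
      simp only [map_smul, smul_apply, smul_eq_mul]
      rw [← mul_assoc, ← sq, hs]
    have e2 : ‖√p • w‖^2 = p * ‖w‖^2 := by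
      rw [norm_smul, mul_pow, Real.norm_eq_abs, sq_abs, hs]
    rw [e1, e2, ← mul_sub, ← mul_add, mul_pow, one_mul, one_mul, mul_div_mul_comm]
    congr 1
    field_simp
  simp only [e] at h
  rw [integral_const_mul] at h
  have hd : Module.finrank ℝ E4 = 4 := by simp
  have h4 : √p ^ 4 = p ^ 2 := by rw [show (4:ℕ) = 2 * 2 from rfl, pow_mul, hs]
  rw [hd, h4, abs_of_pos (by positivity), smul_eq_mul] at h
  unfold Hin
  have h5 : ∫ w : E4, (p * D2 φ z z z - D2 φ z w w) / (p * ‖z‖^2 + ‖w‖^2) ^ 4 =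
    p^2 * ((p^2)⁻¹ * ∫ w : E4, (p * D2 φ z z z - D2 φ z w w) / (p * ‖z‖^2 + ‖w‖^2) ^ 4) := by
    field_simp
  rw [h5, ← h]
  field_simp

lemma ae_ne_zero : ∀ᵐ q : E4 × E4, q.1 ≠ 0 ∧ q.2 ≠ 0 := by
  have h0 : ∀ᵐ x : E4, x ≠ 0 := by
    simp [ae_iff]
  rw [Measure.volume_eq_prod]
  have h1 := Measure.quasiMeasurePreserving_fst (μ := (volume : Measure E4)) (ν := (volume : Measure E4)) |>.ae h0
  have h2 := Measure.quasiMeasurePreserving_snd (μ := (volume : Measure E4)) (ν := (volume : Measure E4)) |>.ae h0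
  filter_upwards [h1, h2] with q a b using ⟨a, b⟩

lemma S_eval (l : ℝ) (hl : 0 < l) (φ : SchwartzMap E4 ℝ) (t : ℝ) :
    ∫ q, mm (t + sg l q) ^ 2 * ker φ q = (∫ z, Hin φ 1 z) * mm t := by
  set u := Real.sigmoid t with hu
  have hu0 : 0 < u := Real.sigmoid_pos t
  have hu1 : u < 1 := Real.sigmoid_lt_one t
  have hm : mm t = u * (1 - u) := rfl
  have hmp := mm_pos t
  set f : E4 × E4 → ℝ := fun q => mm t ^ 2 * (D2 φ (q.1 + q.2) q.1 q.2 / (u * ‖q.1‖^2 + (1 - u) * ‖q.2‖^2) ^ 4) with hf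
  have hae : (fun q => mm (t + sg l q) ^ 2 * ker φ q) =ᵐ[volume] f := by
    filter_upwards [ae_ne_zero] with q hq
    exact mm_sg l hl t q.1 q.2 hq.1 hq.2 _
  have hsm := sg_measurable l
  have hmm := mm_cont.measurable
  have hInt : Integrable (fun q => mm (t + sg l q) ^ 2 * ker φ q) := by
    refine ker_integrable l hl φ _ (by fun_prop) 1 fun q => ?_
    rw [abs_of_nonneg (by positivity)]
    have h1 : mm (t + sg l q) ^ 2 ≤ 1 := (mm_sq_le _).trans (mm_le_one _)
    nlinarith [sq_nonneg (Real.log (‖q.1‖ / l)), sq_nonneg (Real.log (‖q.2‖ / l)),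
      mul_nonneg (sq_nonneg (Real.log (‖q.1‖ / l))) (sq_nonneg (Real.log (‖q.2‖ / l)))]
  have hfi : Integrable f := hInt.congr hae
  rw [integral_congr_ae hae]
  set T : E4 × E4 → E4 × E4 := fun p => ((1 - u) • p.1 + p.2, -((1 - u) • p.1 + p.2) + p.1) with hT
  have mp1 : MeasurePreserving (fun p : E4 × E4 => (p.1, (1 - u) • p.1 + p.2))
      ((volume : Measure E4).prod volume) ((volume : Measure E4).prod volume) :=
    (MeasurePreserving.id (volume : Measure E4)).skew_product (g := fun a b => (1 - u) • a + b)
      (by simp only [Function.uncurry_def]; fun_prop)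
      (Filter.Eventually.of_forall fun a => map_add_left_eq_self volume _)
  have mp : MeasurePreserving T ((volume : Measure E4).prod volume) ((volume : Measure E4).prod volume) :=
    (measurePreserving_prod_neg_add_swap (volume : Measure E4) (volume : Measure E4)).comp mp1
  rw [Measure.volume_eq_prod] at hfi ⊢
  have hfT : Integrable (fun p => f (T p)) ((volume : Measure E4).prod volume) :=
    mp.integrable_comp_of_integrable hfi
  have e1 : ∫ q, f q ∂((volume : Measure E4).prod volume) = ∫ p, f (T p) ∂((volume : Measure E4).prod volume) := by
    conv_lhs => rw [← mp.map_eq]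
    rw [integral_map mp.aemeasurable]
    rw [mp.map_eq]; exact hfi.aestronglyMeasurable
  rw [e1, integral_prod _ hfT, ← integral_mul_const]
  refine integral_congr_ae ?_
  filter_upwards [hfT.prod_right_ae] with z hz
  have hsplit : ∫ w, f (T (z, w)) = 
      ∫ w, (1/2) * (f (T (z, w)) + f (T (z, -w))) := by
    have hz' : Integrable (fun w => f (T (z, -w))) := hz.comp_neg
    rw [integral_const_mul (1/2 : ℝ) (fun w => f (T (z, w)) + f (T (z, -w))), integral_add hz hz',
      integral_neg_eq_self (fun w => f (T (z, w)))]
    ring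
  rw [hsplit]
  have e2 : ∀ w, (1/2) * (f (T (z, w)) + f (T (z, -w))) =
      mm t ^ 2 * ((mm t * D2 φ z z z - D2 φ z w w) / (mm t * ‖z‖^2 + ‖w‖^2) ^ 4) := by
    have key : ∀ w, f (T (z, w)) = mm t ^ 2 * ((mm t * D2 φ z z z - D2 φ z w w + u * D2 φ z w z - (1 - u) * D2 φ z z w)
        / (mm t * ‖z‖^2 + ‖w‖^2) ^ 4) := by
      intro w
      simp only [hf, hT]
      have a1 : (1 - u) • z + w + (-((1 - u) • z + w) + z) = z := by abel
      have a2 : -((1 - u) • z + w) + z = u • z - w := by rw [sub_smul, one_smul]; abel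
      rw [a1, a2]
      have n1 : ‖(1 - u) • z + w‖^2 = (1-u)^2 * ‖z‖^2 + 2 * ((1-u) * inner ℝ z w) + ‖w‖^2 := by
        rw [norm_add_sq_real, norm_smul, mul_pow, Real.norm_eq_abs, sq_abs, inner_smul_left]; simp
      have n2 : ‖u • z - w‖^2 = u^2 * ‖z‖^2 - 2 * (u * inner ℝ z w) + ‖w‖^2 := by
        rw [norm_sub_sq_real, norm_smul, mul_pow, Real.norm_eq_abs, sq_abs, inner_smul_left]; simp
      rw [n1, n2, hm]
      congr 2
      · simp only [map_add, map_sub, map_smul, add_apply, smul_apply, smul_eq_mul]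
        ring
      · ring
    intro w
    rw [key, key]
    simp only [map_neg, neg_apply, norm_neg]
    ring
  simp only [e2]
  rw [integral_const_mul]
  have := Hin_scale φ (mm t) hmp z
  unfold Hin at this ⊢
  rw [this]
  field_simp

lemma triple (l : ℝ) (hl : 0 < l) (φ : SchwartzMap E4 ℝ) (f R : ℝ → ℝ) (hf : Measurable f) (hf0 : ∀ t, 0 ≤ f t)
    (hi : ∀ s, Integrable (fun t => f t * mm (t + s) ^ 2)) (hR : ∀ s, ∫ t, f t * mm (t + s) ^ 2 = R s)
    (hRi : Integrable (fun q => R (sg l q) * ker φ q)) :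
    ∫ q, R (sg l q) * ker φ q = (∫ z, Hin φ 1 z) * ∫ t, f t * mm t := by
  have hsm := sg_measurable l
  have hmm := mm_cont.measurable
  have hk := ker_measurable φ
  have hmeas : Measurable (fun p : (E4 × E4) × ℝ => f p.2 * mm (p.2 + sg l p.1) ^ 2 * ker φ p.1) :=
    ((hf.comp measurable_snd).mul ((hmm.comp (measurable_snd.add (hsm.comp measurable_fst))).pow_const 2)).mul
      (hk.comp measurable_fst)
  have hJ : Integrable (fun p : (E4 × E4) × ℝ => f p.2 * mm (p.2 + sg l p.1) ^ 2 * ker φ p.1)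
      ((volume : Measure (E4 × E4)).prod (volume : Measure ℝ)) := by
    refine (integrable_prod_iff hmeas.aestronglyMeasurable).2 ⟨?_, ?_⟩
    · exact Filter.Eventually.of_forall fun q => (hi (sg l q)).mul_const (ker φ q)
    · refine hRi.norm.congr (Filter.Eventually.of_forall fun q => ?_)
      have hR0 : 0 ≤ R (sg l q) := by
        rw [← hR]; exact integral_nonneg fun t => mul_nonneg (hf0 t) (sq_nonneg _)
      have e : ∀ t, ‖f t * mm (t + sg l q) ^ 2 * ker φ q‖ = f t * mm (t + sg l q) ^ 2 * ‖ker φ q‖ := fun t => by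
        rw [norm_mul, Real.norm_of_nonneg (mul_nonneg (hf0 t) (sq_nonneg _))]
      simp only [e]
      rw [integral_mul_const, norm_mul, Real.norm_of_nonneg hR0, ← hR]
  have hsw := integral_integral_swap (f := fun (q : E4 × E4) (t : ℝ) => f t * mm (t + sg l q) ^ 2 * ker φ q) hJ
  simp only [integral_mul_const, hR] at hsw
  rw [hsw, ← integral_const_mul]
  congr 1; ext t
  simp only [mul_assoc]
  rw [integral_const_mul, S_eval l hl]
  ring

lemma log_bd (a b : ℝ) : 1 ≤ (1 + a^2) * (1 + b^2) := by nlinarith [sq_nonneg (a*b), sq_nonneg a, sq_nonneg b]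

/-- the renormalized bikini (two-bubble chain) amplitude: the
convolution `R_4[r^{-4}] * R_4[r^{-4}]` equals `4π² R_4[r^{-4} log(r/l)] - π⁴ δ`,
i.e. for every Schwartz `φ` the double integral below is absolutely convergent and
`∫∫ |x|^{-4}|y|^{-4} log(|x|/l) log(|y|/l) Σ_{i,j} x_i y_j ∂_i∂_j φ(x+y) dx dy
  = -2π² ∫ |z|^{-4} log²(|z|/l) (z·∇φ(z)) dz - π⁴ φ(0)`. -/
theorem stmt_17 (l : ℝ) (hl : 0 < l) (φ : SchwartzMap (EuclideanSpace ℝ (Fin 4)) ℝ) :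
    Integrable (fun q : EuclideanSpace ℝ (Fin 4) × EuclideanSpace ℝ (Fin 4) =>
        ‖q.1‖ ^ (-(4 : ℝ)) * ‖q.2‖ ^ (-(4 : ℝ)) * Real.log (‖q.1‖ / l) *
          Real.log (‖q.2‖ / l) *
          ∑ i : Fin 4, ∑ j : Fin 4, q.1 i * q.2 j *
            fderiv ℝ (fun z => fderiv ℝ (⇑φ) z (EuclideanSpace.single j 1)) (q.1 + q.2)
              (EuclideanSpace.single i 1)) ∧
    (∫ q : EuclideanSpace ℝ (Fin 4) × EuclideanSpace ℝ (Fin 4),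
        ‖q.1‖ ^ (-(4 : ℝ)) * ‖q.2‖ ^ (-(4 : ℝ)) * Real.log (‖q.1‖ / l) *
          Real.log (‖q.2‖ / l) *
          ∑ i : Fin 4, ∑ j : Fin 4, q.1 i * q.2 j *
            fderiv ℝ (fun z => fderiv ℝ (⇑φ) z (EuclideanSpace.single j 1)) (q.1 + q.2)
              (EuclideanSpace.single i 1))
      = -2 * Real.pi ^ 2 *
            (∫ z : EuclideanSpace ℝ (Fin 4),
              ‖z‖ ^ (-(4 : ℝ)) * (Real.log (‖z‖ / l)) ^ 2 * fderiv ℝ (⇑φ) z z)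
          - Real.pi ^ 4 * φ 0 := by
  have hfun : ∀ q : E4 × E4, ‖q.1‖ ^ (-(4 : ℝ)) * ‖q.2‖ ^ (-(4 : ℝ)) * Real.log (‖q.1‖ / l) *
          Real.log (‖q.2‖ / l) *
          ∑ i : Fin 4, ∑ j : Fin 4, q.1 i * q.2 j *
            fderiv ℝ (fun z => fderiv ℝ (⇑φ) z (EuclideanSpace.single j 1)) (q.1 + q.2)
              (EuclideanSpace.single i 1) =
      (Real.log (‖q.1‖ / l) * Real.log (‖q.2‖ / l)) * ker φ q := by
    intro q
    rw [D2_sum, ker]; ring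
  simp only [hfun]
  have hsm := sg_measurable l
  have i00 : Integrable (fun q : E4 × E4 => 1 * ker φ q) :=
    ker_integrable l hl φ (fun _ => 1) (by fun_prop) 1 fun q => by
      simpa using log_bd _ _
  have i20 : Integrable (fun q : E4 × E4 => Real.log (‖q.1‖ / l) ^ 2 * ker φ q) :=
    ker_integrable l hl φ (fun q => Real.log (‖q.1‖ / l) ^ 2) (by fun_prop) 1 fun q => by
      rw [abs_of_nonneg (by positivity)]
      generalize Real.log (‖q.1‖ / l) = a
      generalize Real.log (‖q.2‖ / l) = b
      nlinarith [sq_nonneg (a*b), sq_nonneg a, sq_nonneg b]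
  have i02 : Integrable (fun q : E4 × E4 => Real.log (‖q.2‖ / l) ^ 2 * ker φ q) :=
    ker_integrable l hl φ (fun q => Real.log (‖q.2‖ / l) ^ 2) (by fun_prop) 1 fun q => by
      rw [abs_of_nonneg (by positivity)]
      generalize Real.log (‖q.1‖ / l) = a
      generalize Real.log (‖q.2‖ / l) = b
      nlinarith [sq_nonneg (a*b), sq_nonneg a, sq_nonneg b]
  have i11 : Integrable (fun q : E4 × E4 => (Real.log (‖q.1‖ / l) * Real.log (‖q.2‖ / l)) * ker φ q) :=
    ker_integrable l hl φ (fun q => Real.log (‖q.1‖ / l) * Real.log (‖q.2‖ / l)) (by fun_prop) 1 fun q => by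
      generalize Real.log (‖q.1‖ / l) = a
      generalize Real.log (‖q.2‖ / l) = b
      rw [abs_le]; constructor <;> nlinarith [sq_nonneg (a*b), sq_nonneg (a+b), sq_nonneg (a-b)]
  have isg : Integrable (fun q : E4 × E4 => sg l q ^ 2 * ker φ q) :=
    ker_integrable l hl φ (fun q => sg l q ^ 2) (by fun_prop) 8 fun q => by
      rw [abs_of_nonneg (by positivity)]
      unfold sg
      generalize Real.log (‖q.1‖ / l) = a
      generalize Real.log (‖q.2‖ / l) = b
      nlinarith [sq_nonneg (a*b), sq_nonneg (a+b), sq_nonneg (a-b)]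
  refine ⟨i11, ?_⟩
  set Q := ∫ z, Hin φ 1 z with hQ
  set A0 := ∫ q : E4 × E4, 1 * ker φ q with hA0
  set κ := ∫ t, t^2 * mm t ^ 2 with hκ
  set I2 := ∫ q : E4 × E4, sg l q ^ 2 * ker φ q with hI2
  have vA0 : A0 = 4 * π^4 * φ 0 := by
    have h1 := ker_weight_fst φ (fun _ => 1) i00
    have h2 := radial_eval φ 0
    simp only [zero_add] at h2
    simp only [mul_one] at h1
    rw [hA0, h1, h2]; ring
  have t0 : A0 / 6 = Q := by
    have := triple l hl φ (fun _ => 1) (fun _ => 1/6) (by fun_prop) (fun _ => zero_le_one)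
      (fun s => (conv_one s).1) (fun s => (conv_one s).2)
      ((i00.const_mul (1/6)).congr (Filter.Eventually.of_forall fun q => by simp))
    simp only [one_mul] at this
    rw [val_mm, integral_const_mul] at this
    simp only [hA0, one_mul]
    linarith
  have t2 : κ * A0 + I2 / 6 = Q * (6 * κ + 2) := by
    have hi : Integrable (fun q : E4 × E4 => κ * (1 * ker φ q) + (1/6) * (sg l q ^ 2 * ker φ q)) :=
      (i00.const_mul κ).add (isg.const_mul (1/6))
    have heq : (fun q : E4 × E4 => κ * (1 * ker φ q) + (1/6) * (sg l q ^ 2 * ker φ q)) =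
      fun q => (κ + sg l q ^ 2 / 6) * ker φ q := by ext q; ring
    have := triple l hl φ (fun t => t^2) (fun s => κ + s^2/6) (by fun_prop) (fun t => sq_nonneg t)
      (fun s => (conv_sq s).1) (fun s => (conv_sq s).2) (heq ▸ hi)
    rw [val_tmm, ← heq, integral_add (i00.const_mul κ) (isg.const_mul (1/6)),
      integral_const_mul κ (fun q : E4 × E4 => 1 * ker φ q), integral_const_mul (1/6 : ℝ) (fun q : E4 × E4 => sg l q ^ 2 * ker φ q)] at this
    linarith
  have vI2 : I2 = 8 * π^4 * φ 0 := by
    rw [← t0, vA0] at t2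
    linarith
  have v20 := ker_weight_fst φ (fun x => Real.log (‖x‖ / l) ^ 2) i20
  have v02 : ∫ q : E4 × E4, Real.log (‖q.2‖ / l) ^ 2 * ker φ q = ∫ q : E4 × E4, Real.log (‖q.1‖ / l) ^ 2 * ker φ q := by
    rw [Measure.volume_eq_prod, ← integral_prod_swap]
    simp only [ker_swap, Prod.snd_swap]
  have hdec : (fun q : E4 × E4 => (Real.log (‖q.1‖ / l) * Real.log (‖q.2‖ / l)) * ker φ q) = fun q =>
      (1/2) * (Real.log (‖q.1‖ / l) ^ 2 * ker φ q + Real.log (‖q.2‖ / l) ^ 2 * ker φ q) - (1/8) * (sg l q ^ 2 * ker φ q) := by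
    ext q; unfold sg; ring
  have i2 : Integrable (fun q : E4 × E4 => Real.log (‖q.1‖ / l) ^ 2 * ker φ q + Real.log (‖q.2‖ / l) ^ 2 * ker φ q) :=
    i20.add i02
  rw [hdec, integral_sub (i2.const_mul (1/2)) (isg.const_mul (1/8)),
    integral_const_mul (1/2 : ℝ) (fun q : E4 × E4 => Real.log (‖q.1‖ / l) ^ 2 * ker φ q + Real.log (‖q.2‖ / l) ^ 2 * ker φ q),
    integral_const_mul (1/8 : ℝ) (fun q : E4 × E4 => sg l q ^ 2 * ker φ q),
    integral_add i20 i02, v02, v20, ← hI2, vI2]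
  ring

end
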